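/- Let k be a field, H a commutative Hopf algebra over k with bijective antipode, and let M, N be left-right Yetter-Drinfeld modules over H with N finitely generated and projective as a left H-module. Then the projective dimension of M ⊗_H N in the category of Yetter-Drinfeld modules is at most the projective dimension of M in that category. -/

import Mathlib

/-!
Common definitions for formalizing "Semisimplicity of the categories of
Yetter-Drinfeld modules and Long dimodules" (Caenepeel, Guédénon).
-/

open TensorProduct

noncomputable section
namespace YDPaper

section RingPart

variable (k H : Type) [CommRing k] [Ring H] [HopfAlgebra k H]

/-- `ρ : M →ₗ[k] M ⊗[k] H` is a (coassociative, counital) right `H`-comodule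
structure on `M`. -/
def IsComod {M : Type} [AddCommGroup M] [Module k M] (ρ : M →ₗ[k] M ⊗[k] H) : Prop :=
  (∀ m : M, (TensorProduct.rid k M)
      ((LinearMap.lTensor M (Coalgebra.counit (R := k) (A := H))) (ρ m)) = m) ∧
  (∀ m : M, (TensorProduct.assoc k M H H) ((LinearMap.rTensor H ρ) (ρ m)) =
      (LinearMap.lTensor M (Coalgebra.comul (R := k) (A := H))) (ρ m))

/-- The iterated comultiplication `h ↦ (h₁ ⊗ h₂) ⊗ h₃`. -/
def Delta2 : H →ₗ[k] (H ⊗[k] H) ⊗[k] H :=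
  (LinearMap.rTensor H (Coalgebra.comul (R := k) (A := H))).comp
    (Coalgebra.comul (R := k) (A := H))

/-- The Yetter-Drinfeld compatibility condition
`ρ(h • m) = h₂ • m₀ ⊗ h₃ m₁ S⁻¹(h₁)`, expressed via arbitrary Sweedler
decompositions of `Δ²(h)` and `ρ(m)` into finite sums of pure tensors. -/
def IsYDCompat (Sinv : H →ₗ[k] H) {M : Type} [AddCommGroup M] [Module k M] [Module H M]
    (ρ : M →ₗ[k] M ⊗[k] H) : Prop :=
  ∀ (h : H) (m : M) (s t : Finset ℕ) (a b c : ℕ → H) (m₀ : ℕ → M) (m₁ : ℕ → H),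
    (∑ i ∈ s, (a i ⊗ₜ[k] b i) ⊗ₜ[k] c i) = Delta2 k H h →
    (∑ j ∈ t, m₀ j ⊗ₜ[k] m₁ j) = ρ m →
    ρ (h • m) = ∑ i ∈ s, ∑ j ∈ t, (b i • m₀ j) ⊗ₜ[k] (c i * m₁ j * Sinv (a i))

/-- The `k`-linear map `m ↦ h • m`. -/
def smulMap {M : Type} [AddCommGroup M] [Module k M] [Module H M] [SMulCommClass H k M]
    (h : H) : M →ₗ[k] M where
  toFun m := h • m
  map_add' := smul_add h
  map_smul' c m := (smul_comm h c m)

/-- The Long dimodule compatibility condition `ρ(h • m) = h • m₀ ⊗ m₁`. -/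
def IsLongCompat {M : Type} [AddCommGroup M] [Module k M] [Module H M] [SMulCommClass H k M]
    (ρ : M →ₗ[k] M ⊗[k] H) : Prop :=
  ∀ (h : H) (m : M), ρ (h • m) = (LinearMap.rTensor H (smulMap k H h)) (ρ m)

/-- Morphisms in the categories of Yetter-Drinfeld modules and of Long dimodules:
`H`-linear and `H`-colinear maps. -/
def IsHom {A B : Type} [AddCommGroup A] [Module k A] [Module H A]
    [AddCommGroup B] [Module k B] [Module H B]
    (ρA : A →ₗ[k] A ⊗[k] H) (ρB : B →ₗ[k] B ⊗[k] H) (f : A →ₗ[k] B) : Prop :=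
  (∀ (h : H) (a : A), f (h • a) = h • f a) ∧
  ρB.comp f = (LinearMap.rTensor H f).comp ρA

/-- `H`-colinearity of a `k`-linear map between right `H`-comodules. -/
def IsColin {A B : Type} [AddCommGroup A] [Module k A]
    [AddCommGroup B] [Module k B]
    (ρA : A →ₗ[k] A ⊗[k] H) (ρB : B →ₗ[k] B ⊗[k] H) (f : A →ₗ[k] B) : Prop :=
  ρB.comp f = (LinearMap.rTensor H f).comp ρA

/-- A bundled left-right Yetter-Drinfeld module over `H` (with chosen inverse `Sinv`
of the antipode). -/
structure YDCat (Sinv : H →ₗ[k] H) where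
  M : Type
  [iAdd : AddCommGroup M]
  [iModk : Module k M]
  [iModH : Module H M]
  [iTower : IsScalarTower k H M]
  [iComm : SMulCommClass H k M]
  ρ : M →ₗ[k] M ⊗[k] H
  comod : IsComod k H ρ
  compat : IsYDCompat k H Sinv ρ

attribute [instance] YDCat.iAdd YDCat.iModk YDCat.iModH YDCat.iTower YDCat.iComm

/-- A bundled left-right Long dimodule over `H`. -/
structure LongCat where
  M : Type
  [iAdd : AddCommGroup M]
  [iModk : Module k M]
  [iModH : Module H M]
  [iTower : IsScalarTower k H M]
  [iComm : SMulCommClass H k M]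
  ρ : M →ₗ[k] M ⊗[k] H
  comod : IsComod k H ρ
  compat : IsLongCompat k H ρ

attribute [instance] LongCat.iAdd LongCat.iModk LongCat.iModH LongCat.iTower LongCat.iComm

/-- A bundled right `H`-comodule. -/
structure ComodCat where
  V : Type
  [iAdd : AddCommGroup V]
  [iModk : Module k V]
  ρ : V →ₗ[k] V ⊗[k] H
  comod : IsComod k H ρ

attribute [instance] ComodCat.iAdd ComodCat.iModk

section Subobjects

variable {k H}
variable {M : Type} [AddCommGroup M] [Module k M] [Module H M] [IsScalarTower k H M]

/-- A subobject in the category of Yetter-Drinfeld modules (or Long dimodules):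
an `H`-submodule which is stable under the coaction, i.e. `ρ(p) ⊆ p ⊗ H`. -/
def IsSubobject (ρ : M →ₗ[k] M ⊗[k] H) (p : Submodule H M) : Prop :=
  ∀ m ∈ p, ρ m ∈ LinearMap.range (LinearMap.rTensor H (p.restrictScalars k).subtype)

/-- A simple subobject: a nonzero coaction-stable `H`-submodule with no proper
nonzero coaction-stable `H`-submodules. -/
def IsSimpleSubobject (ρ : M →ₗ[k] M ⊗[k] H) (p : Submodule H M) : Prop :=
  IsSubobject ρ p ∧ p ≠ ⊥ ∧
    ∀ q : Submodule H M, IsSubobject ρ q → q ≤ p → q = ⊥ ∨ q = p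

/-- `M` is the (internal) direct sum of a family of simple subobjects which are
finitely generated as `H`-modules. -/
def IsSemisimpleObj (ρ : M →ₗ[k] M ⊗[k] H) : Prop :=
  ∃ (ι : Type) (S : ι → Submodule H M),
    (∀ i, IsSimpleSubobject ρ (S i) ∧ (S i).FG) ∧
    iSupIndep S ∧ (⨆ i, S i) = ⊤

end Subobjects

section Subcomodules

variable {k H}
variable {V : Type} [AddCommGroup V] [Module k V]

/-- A subcomodule: a `k`-submodule stable under the coaction. -/
def IsSubcomod (ρ : V →ₗ[k] V ⊗[k] H) (p : Submodule k V) : Prop :=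
  ∀ v ∈ p, ρ v ∈ LinearMap.range (LinearMap.rTensor H p.subtype)

/-- A simple subcomodule. -/
def IsSimpleSubcomod (ρ : V →ₗ[k] V ⊗[k] H) (p : Submodule k V) : Prop :=
  IsSubcomod ρ p ∧ p ≠ ⊥ ∧
    ∀ q : Submodule k V, IsSubcomod ρ q → q ≤ p → q = ⊥ ∨ q = p

/-- A comodule is semisimple if it is the internal direct sum of a family of simple
subcomodules. -/
def IsSemisimpleComod (ρ : V →ₗ[k] V ⊗[k] H) : Prop :=
  ∃ (ι : Type) (S : ι → Submodule k V),
    (∀ i, IsSimpleSubcomod ρ (S i)) ∧ iSupIndep S ∧ (⨆ i, S i) = ⊤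

end Subcomodules

/-- `H` is cosemisimple: every right `H`-comodule is a direct sum of simple
subcomodules. -/
def Cosemisimple : Prop := ∀ C : ComodCat k H, IsSemisimpleComod C.ρ

section Coinv

variable {k H}
variable {A B : Type} [AddCommGroup A] [Module k A] [AddCommGroup B] [Module k B]

/-- The coinvariants `M^{co H} = { m | ρ m = m ⊗ 1 }` of a right `H`-comodule. -/
def coinv (ρ : A →ₗ[k] A ⊗[k] H) : Submodule k A :=
  LinearMap.ker (ρ - (TensorProduct.mk k A H).flip 1)

lemma mem_coinv {ρ : A →ₗ[k] A ⊗[k] H} {a : A} :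
    a ∈ coinv ρ ↔ ρ a = a ⊗ₜ[k] (1 : H) := by
  simp [coinv, LinearMap.mem_ker, sub_eq_zero]

/-- The map induced on coinvariants by an `H`-colinear map. -/
def coinvMap {ρA : A →ₗ[k] A ⊗[k] H} {ρB : B →ₗ[k] B ⊗[k] H} (f : A →ₗ[k] B)
    (hf : IsColin k H ρA ρB f) : ↥(coinv ρA) →ₗ[k] ↥(coinv ρB) :=
  f.restrict (fun a ha => by
    have h1 : ρA a = a ⊗ₜ[k] (1 : H) := mem_coinv.1 ha
    have h2 : ρB (f a) = (LinearMap.rTensor H f) (ρA a) := by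
      have := congrArg (fun (g : A →ₗ[k] B ⊗[k] H) => g a) hf
      simpa using this
    rw [mem_coinv, h2, h1, LinearMap.rTensor_tmul])

end Coinv

/-- Exactness of the coinvariants functor on the category of Yetter-Drinfeld
modules. -/
def CoinvExactYD (Sinv : H →ₗ[k] H) : Prop :=
  ∀ (A B C : YDCat k H Sinv) (f : A.M →ₗ[k] B.M) (g : B.M →ₗ[k] C.M)
    (hf : IsHom k H A.ρ B.ρ f) (hg : IsHom k H B.ρ C.ρ g),
    Function.Injective f → Function.Surjective g →
    LinearMap.range f = LinearMap.ker g →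
    Function.Injective (coinvMap f hf.2) ∧
    LinearMap.range (coinvMap f hf.2) = LinearMap.ker (coinvMap g hg.2) ∧
    Function.Surjective (coinvMap g hg.2)

/-- Exactness of the coinvariants functor on the category of right `H`-comodules. -/
def CoinvExactComod : Prop :=
  ∀ (A B C : ComodCat k H) (f : A.V →ₗ[k] B.V) (g : B.V →ₗ[k] C.V)
    (hf : IsColin k H A.ρ B.ρ f) (hg : IsColin k H B.ρ C.ρ g),
    Function.Injective f → Function.Surjective g →
    LinearMap.range f = LinearMap.ker g →
    Function.Injective (coinvMap f hf) ∧
    LinearMap.range (coinvMap f hf) = LinearMap.ker (coinvMap g hg) ∧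
    Function.Surjective (coinvMap g hg)

section Eval

variable {k H}
variable {M N : Type} [AddCommGroup M] [Module k M] [Module H M]
  [IsScalarTower k H M] [SMulCommClass H k M]
  [AddCommGroup N] [Module k N] [Module H N] [IsScalarTower k H N] [SMulCommClass H k N]

/-- Evaluation at `m` of `H`-linear maps, as a `k`-linear map. -/
def evalAtH (m : M) : (M →ₗ[H] N) →ₗ[k] N where
  toFun f := f m
  map_add' _ _ := rfl
  map_smul' _ _ := rfl

/-- Evaluation at `m` of `k`-linear maps, as a `k`-linear map. -/
def evalAtK {V : Type} [AddCommGroup V] [Module k V] (v : V) :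
    (V →ₗ[k] N) →ₗ[k] N where
  toFun f := f v
  map_add' _ _ := rfl
  map_smul' _ _ := rfl

/-- Contraction `N ⊗ H → N` along a functional `φ : H → k`. -/
def contract (φ : H →ₗ[k] k) : N ⊗[k] H →ₗ[k] N :=
  (TensorProduct.rid k N).toLinearMap.comp (LinearMap.lTensor N φ)

/-- Post-composition with an `H`-linear map, as a `k`-linear map
`Hom_H(X, M) → Hom_H(X, N)`; here `X` is the (implicit) source. -/
def postcompH {X : Type} [AddCommGroup X] [Module k X] [Module H X]
    [IsScalarTower k H X] [SMulCommClass H k X]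
    (f : M →ₗ[k] N) (hf : ∀ (h : H) (m : M), f (h • m) = h • f m) :
    (X →ₗ[H] M) →ₗ[k] (X →ₗ[H] N) where
  toFun φ :=
    { toFun := fun x => f (φ x)
      map_add' := fun x y => by simp
      map_smul' := fun h x => by simp [hf] }
  map_add' φ ψ := by ext x; simp
  map_smul' c φ := by ext x; simp

end Eval

/-- Condition (†) for the category of Yetter-Drinfeld modules: for every
Yetter-Drinfeld module `X` which is finitely generated as a left `H`-module,
the functor `Hom_H(X, -)` is exact on the category of Yetter-Drinfeld modules. -/
def DaggerYD (Sinv : H →ₗ[k] H) : Prop :=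
  ∀ X : YDCat k H Sinv, Module.Finite H X.M →
  ∀ (A B C : YDCat k H Sinv) (f : A.M →ₗ[k] B.M) (g : B.M →ₗ[k] C.M)
    (hf : IsHom k H A.ρ B.ρ f) (hg : IsHom k H B.ρ C.ρ g),
    Function.Injective f → Function.Surjective g →
    LinearMap.range f = LinearMap.ker g →
    Function.Injective (postcompH (X := X.M) f hf.1) ∧
    LinearMap.range (postcompH (X := X.M) f hf.1) =
      LinearMap.ker (postcompH (X := X.M) g hg.1) ∧
    Function.Surjective (postcompH (X := X.M) g hg.1)

/-- Condition (†) for the category of Long dimodules. -/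
def DaggerLong : Prop :=
  ∀ X : LongCat k H, Module.Finite H X.M →
  ∀ (A B C : LongCat k H) (f : A.M →ₗ[k] B.M) (g : B.M →ₗ[k] C.M)
    (hf : IsHom k H A.ρ B.ρ f) (hg : IsHom k H B.ρ C.ρ g),
    Function.Injective f → Function.Surjective g →
    LinearMap.range f = LinearMap.ker g →
    Function.Injective (postcompH (X := X.M) f hf.1) ∧
    LinearMap.range (postcompH (X := X.M) f hf.1) =
      LinearMap.ker (postcompH (X := X.M) g hg.1) ∧
    Function.Surjective (postcompH (X := X.M) g hg.1)

/-- Projective object in the category of Yetter-Drinfeld modules. -/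
def IsProjectiveYD (Sinv : H →ₗ[k] H) (P : YDCat k H Sinv) : Prop :=
  ∀ (A B : YDCat k H Sinv) (g : A.M →ₗ[k] B.M) (f : P.M →ₗ[k] B.M),
    IsHom k H A.ρ B.ρ g → Function.Surjective g → IsHom k H P.ρ B.ρ f →
    ∃ l : P.M →ₗ[k] A.M, IsHom k H P.ρ A.ρ l ∧ g.comp l = f

/-- Projective object in the category of Long dimodules. -/
def IsProjectiveLong (P : LongCat k H) : Prop :=
  ∀ (A B : LongCat k H) (g : A.M →ₗ[k] B.M) (f : P.M →ₗ[k] B.M),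
    IsHom k H A.ρ B.ρ g → Function.Surjective g → IsHom k H P.ρ B.ρ f →
    ∃ l : P.M →ₗ[k] A.M, IsHom k H P.ρ A.ρ l ∧ g.comp l = f

/-- Injective object in the category of Yetter-Drinfeld modules. -/
def IsInjectiveYD (Sinv : H →ₗ[k] H) (I : YDCat k H Sinv) : Prop :=
  ∀ (A B : YDCat k H Sinv) (ι : A.M →ₗ[k] B.M) (f : A.M →ₗ[k] I.M),
    IsHom k H A.ρ B.ρ ι → Function.Injective ι → IsHom k H A.ρ I.ρ f →
    ∃ g : B.M →ₗ[k] I.M, IsHom k H B.ρ I.ρ g ∧ g.comp ι = f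

/-- Projective object in the category of right `H`-comodules. -/
def IsProjectiveComod (P : ComodCat k H) : Prop :=
  ∀ (A B : ComodCat k H) (g : A.V →ₗ[k] B.V) (f : P.V →ₗ[k] B.V),
    IsColin k H A.ρ B.ρ g → Function.Surjective g → IsColin k H P.ρ B.ρ f →
    ∃ l : P.V →ₗ[k] A.V, IsColin k H P.ρ A.ρ l ∧ g.comp l = f

section HomLemmas

variable {k H}
variable {A B C : Type} [AddCommGroup A] [Module k A] [Module H A]
  [AddCommGroup B] [Module k B] [Module H B]
  [AddCommGroup C] [Module k C] [Module H C]

lemma IsHom.comp' {ρA : A →ₗ[k] A ⊗[k] H} {ρB : B →ₗ[k] B ⊗[k] H} {ρC : C →ₗ[k] C ⊗[k] H}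
    {f : A →ₗ[k] B} {g : B →ₗ[k] C}
    (hf : IsHom k H ρA ρB f) (hg : IsHom k H ρB ρC g) :
    IsHom k H ρA ρC (g.comp f) := by
  refine ⟨fun h a => by simp [LinearMap.comp_apply, hf.1, hg.1], ?_⟩
  calc ρC.comp (g.comp f) = (ρC.comp g).comp f := by rw [LinearMap.comp_assoc]
    _ = ((LinearMap.rTensor H g).comp ρB).comp f := by rw [hg.2]
    _ = (LinearMap.rTensor H g).comp (ρB.comp f) := by rw [LinearMap.comp_assoc]
    _ = (LinearMap.rTensor H g).comp ((LinearMap.rTensor H f).comp ρA) := by rw [hf.2]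
    _ = ((LinearMap.rTensor H g).comp (LinearMap.rTensor H f)).comp ρA := by
          rw [LinearMap.comp_assoc]
    _ = (LinearMap.rTensor H (g.comp f)).comp ρA := by rw [LinearMap.rTensor_comp]

end HomLemmas

section HomYD

variable {k H}
variable (Sinv : H →ₗ[k] H)

/-- The `k`-module of morphisms of Yetter-Drinfeld modules `Hom_H^H(A, B)`, as a
submodule of the `k`-linear maps. -/
def homYD (A B : YDCat k H Sinv) : Submodule k (A.M →ₗ[k] B.M) where
  carrier := {f | IsHom k H A.ρ B.ρ f}
  add_mem' := by
    rintro f g ⟨hf1, hf2⟩ ⟨hg1, hg2⟩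
    refine ⟨fun h a => by simp [hf1, hg1, smul_add], ?_⟩
    rw [LinearMap.comp_add, LinearMap.rTensor_add, LinearMap.add_comp, hf2, hg2]
  zero_mem' := by
    refine ⟨fun h a => by simp, ?_⟩
    rw [LinearMap.comp_zero, LinearMap.rTensor_zero, LinearMap.zero_comp]
  smul_mem' := by
    rintro c f ⟨hf1, hf2⟩
    refine ⟨fun h a => by
      rw [LinearMap.smul_apply, LinearMap.smul_apply, hf1, smul_comm], ?_⟩
    rw [LinearMap.comp_smul, LinearMap.rTensor_smul, LinearMap.smul_comp, hf2]

/-- Post-composition with a morphism of Yetter-Drinfeld modules, as a `k`-linear map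
between morphism spaces. -/
def postcompYD {X B C : YDCat k H Sinv}
    (g : B.M →ₗ[k] C.M) (hg : IsHom k H B.ρ C.ρ g) :
    ↥(homYD Sinv X B) →ₗ[k] ↥(homYD Sinv X C) where
  toFun f := ⟨g.comp f.1, IsHom.comp' f.2 hg⟩
  map_add' f g' := by ext x; simp
  map_smul' c f := by ext x; simp

/-- An injective resolution `0 → X → I⁰ → I¹ → ⋯` in the category of
Yetter-Drinfeld modules. -/
structure IsInjRes (X : YDCat k H Sinv) (I : ℕ → YDCat k H Sinv)
    (ε : X.M →ₗ[k] (I 0).M) (d : ∀ n, (I n).M →ₗ[k] (I (n + 1)).M) : Prop where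
  eps_hom : IsHom k H X.ρ (I 0).ρ ε
  d_hom : ∀ n, IsHom k H (I n).ρ (I (n + 1)).ρ (d n)
  inj : ∀ n, IsInjectiveYD k H Sinv (I n)
  mono : Function.Injective ε
  exact0 : LinearMap.range ε = LinearMap.ker (d 0)
  exact : ∀ n, LinearMap.range (d n) = LinearMap.ker (d (n + 1))

/-- A projective resolution `⋯ → P₁ → P₀ → X → 0` in the category of
Yetter-Drinfeld modules. -/
structure IsProjRes (X : YDCat k H Sinv) (P : ℕ → YDCat k H Sinv)
    (ε : (P 0).M →ₗ[k] X.M) (d : ∀ n, (P (n + 1)).M →ₗ[k] (P n).M) : Prop where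
  eps_hom : IsHom k H (P 0).ρ X.ρ ε
  d_hom : ∀ n, IsHom k H (P (n + 1)).ρ (P n).ρ (d n)
  proj : ∀ n, IsProjectiveYD k H Sinv (P n)
  epi : Function.Surjective ε
  exact0 : LinearMap.range (d 0) = LinearMap.ker ε
  exact : ∀ n, LinearMap.range (d (n + 1)) = LinearMap.ker (d n)

/-- The projective dimension of `X` in the category of Yetter-Drinfeld modules is
at most `n`. -/
def pdimLE (X : YDCat k H Sinv) (n : ℕ) : Prop :=
  ∃ (P : ℕ → YDCat k H Sinv) (ε : (P 0).M →ₗ[k] X.M)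
    (d : ∀ m, (P (m + 1)).M →ₗ[k] (P m).M),
    IsProjRes Sinv X P ε d ∧ ∀ i, n < i → Subsingleton (P i).M

/-- The injective dimension of `X` in the category of Yetter-Drinfeld modules is
at most `n`. -/
def injdimLE (X : YDCat k H Sinv) (n : ℕ) : Prop :=
  ∃ (I : ℕ → YDCat k H Sinv) (ε : X.M →ₗ[k] (I 0).M)
    (d : ∀ m, (I m).M →ₗ[k] (I (m + 1)).M),
    IsInjRes Sinv X I ε d ∧ ∀ i, n < i → Subsingleton (I i).M

/-- The complex `Hom(X, I⁰) → Hom(X, I¹) → ⋯` of morphism spaces induced by a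
cochain of Yetter-Drinfeld modules. -/
def homCx (X : YDCat k H Sinv) (I : ℕ → YDCat k H Sinv)
    (d : ∀ n, (I n).M →ₗ[k] (I (n + 1)).M)
    (hd : ∀ n, IsHom k H (I n).ρ (I (n + 1)).ρ (d n)) (n : ℕ) :
    ↥(homYD Sinv X (I n)) →ₗ[k] ↥(homYD Sinv X (I (n + 1))) :=
  postcompYD Sinv (d n) (hd n)

/-- Coboundaries of the induced complex. -/
def boundaries (X : YDCat k H Sinv) (I : ℕ → YDCat k H Sinv)
    (d : ∀ n, (I n).M →ₗ[k] (I (n + 1)).M)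
    (hd : ∀ n, IsHom k H (I n).ρ (I (n + 1)).ρ (d n)) :
    ∀ i, Submodule k ↥(homYD Sinv X (I i))
  | 0 => ⊥
  | (i + 1) => LinearMap.range (homCx Sinv X I d hd i)

/-- The `i`-th cohomology (cocycles modulo coboundaries) of the complex
`Hom(X, I⁰) → Hom(X, I¹) → ⋯`; when `I` is an injective resolution of `Y`, this is
`Ext^i(X, Y)`, the `i`-th right derived functor of `Hom_H^H(X, -)`, in the category
of Yetter-Drinfeld modules. -/
abbrev cohomology (X : YDCat k H Sinv) (I : ℕ → YDCat k H Sinv)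
    (d : ∀ n, (I n).M →ₗ[k] (I (n + 1)).M)
    (hd : ∀ n, IsHom k H (I n).ρ (I (n + 1)).ρ (d n)) (i : ℕ) : Type :=
  ↥(Submodule.map (boundaries Sinv X I d hd i).mkQ
      (LinearMap.ker (homCx Sinv X I d hd i)))

end HomYD

section CharProps

variable {k H}
variable (Sinv : H →ₗ[k] H)

/-- Characterizing property of the coaction on `Hom_H(A, B)` for Yetter-Drinfeld
modules `A`, `B`: it is determined by `f₀(m) ⊗ f₁ = f(m₀)₀ ⊗ f(m₀)₁ S(m₁)`. -/
def HomCoactChar (A B : YDCat k H Sinv)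
    (ρQ : (A.M →ₗ[H] B.M) →ₗ[k] (A.M →ₗ[H] B.M) ⊗[k] H) : Prop :=
  ∀ (f : A.M →ₗ[H] B.M) (m : A.M) (t : Finset ℕ) (m₀ : ℕ → A.M) (m₁ : ℕ → H),
    (∑ j ∈ t, m₀ j ⊗ₜ[k] m₁ j) = A.ρ m →
    (LinearMap.rTensor H (evalAtH (N := B.M) m)) (ρQ f) =
      ∑ j ∈ t, (LinearMap.lTensor B.M
          (LinearMap.mulRight k (HopfAlgebra.antipode (R := k) (A := H) (m₁ j))))
        (B.ρ (f (m₀ j)))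

/-- Characterizing property of the coaction on `Hom_k(V, B)` for a comodule `V` and
a Yetter-Drinfeld module `B`: `g₀(v) ⊗ g₁ = g(v₀)₀ ⊗ g(v₀)₁ S(v₁)`. -/
def HomKCoactChar (V : ComodCat k H) (B : YDCat k H Sinv)
    (ρ' : (V.V →ₗ[k] B.M) →ₗ[k] (V.V →ₗ[k] B.M) ⊗[k] H) : Prop :=
  ∀ (g : V.V →ₗ[k] B.M) (v : V.V) (t : Finset ℕ) (v₀ : ℕ → V.V) (v₁ : ℕ → H),
    (∑ j ∈ t, v₀ j ⊗ₜ[k] v₁ j) = V.ρ v →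
    (LinearMap.rTensor H (evalAtK (N := B.M) v)) (ρ' g) =
      ∑ j ∈ t, (LinearMap.lTensor B.M
          (LinearMap.mulRight k (HopfAlgebra.antipode (R := k) (A := H) (v₁ j))))
        (B.ρ (g (v₀ j)))

/-- Characterizing property of the Yetter-Drinfeld coaction on `H ⊗ V`:
`ρ(h ⊗ v) = h₂ ⊗ v₀ ⊗ h₃ v₁ S⁻¹(h₁)`. -/
def HTensorYDChar (V : ComodCat k H)
    (ρT : (H ⊗[k] V.V) →ₗ[k] (H ⊗[k] V.V) ⊗[k] H) : Prop :=
  ∀ (h : H) (v : V.V) (s t : Finset ℕ) (a b c : ℕ → H) (v₀ : ℕ → V.V) (v₁ : ℕ → H),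
    (∑ i ∈ s, (a i ⊗ₜ[k] b i) ⊗ₜ[k] c i) = Delta2 k H h →
    (∑ j ∈ t, v₀ j ⊗ₜ[k] v₁ j) = V.ρ v →
    ρT (h ⊗ₜ[k] v) =
      ∑ i ∈ s, ∑ j ∈ t, (b i ⊗ₜ[k] v₀ j) ⊗ₜ[k] (c i * v₁ j * Sinv (a i))

/-- Characterizing property of the Long dimodule coaction on `H ⊗ V`:
`ρ(h ⊗ v) = h ⊗ v₀ ⊗ v₁`. -/
def HTensorLongChar (V : ComodCat k H)
    (ρT : (H ⊗[k] V.V) →ₗ[k] (H ⊗[k] V.V) ⊗[k] H) : Prop :=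
  ∀ (h : H) (v : V.V) (t : Finset ℕ) (v₀ : ℕ → V.V) (v₁ : ℕ → H),
    (∑ j ∈ t, v₀ j ⊗ₜ[k] v₁ j) = V.ρ v →
    ρT (h ⊗ₜ[k] v) = ∑ j ∈ t, (h ⊗ₜ[k] v₀ j) ⊗ₜ[k] v₁ j

end CharProps

end RingPart

section CommPart

variable {k H : Type} [CommRing k] [CommRing H] [HopfAlgebra k H] (Sinv : H →ₗ[k] H)

/-- Characterizing property of the Yetter-Drinfeld coaction on `M ⊗_H N`:
`ρ(m ⊗ n) = m₀ ⊗ n₀ ⊗ n₁ m₁` (for `H` commutative). -/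
def TensorCoactChar (A B : YDCat k H Sinv)
    (ρT : (A.M ⊗[H] B.M) →ₗ[k] (A.M ⊗[H] B.M) ⊗[k] H) : Prop :=
  ∀ (m : A.M) (n : B.M) (s t : Finset ℕ) (m₀ : ℕ → A.M) (m₁ : ℕ → H)
    (n₀ : ℕ → B.M) (n₁ : ℕ → H),
    (∑ i ∈ s, m₀ i ⊗ₜ[k] m₁ i) = A.ρ m →
    (∑ j ∈ t, n₀ j ⊗ₜ[k] n₁ j) = B.ρ n →
    ρT (m ⊗ₜ[H] n) =
      ∑ i ∈ s, ∑ j ∈ t, (m₀ i ⊗ₜ[H] n₀ j) ⊗ₜ[k] (n₁ j * m₁ i)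

/-- Restriction along `v ↦ 1 ⊗ v`, i.e. the canonical map
`Hom_H(H ⊗ V, N) → Hom_k(V, N)`, `f ↦ (v ↦ f(1 ⊗ v))`. -/
def resUnitMap (V : Type) [AddCommGroup V] [Module k V] (N : Type) [AddCommGroup N]
    [Module k N] [Module H N] [IsScalarTower k H N] [SMulCommClass H k N] :
    ((H ⊗[k] V) →ₗ[H] N) →ₗ[k] (V →ₗ[k] N) where
  toFun f := (f.restrictScalars k).comp ((TensorProduct.mk k H V) 1)
  map_add' f g := by ext v; rfl
  map_smul' c f := by ext v; rfl

end CommPart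

section Main
variable {k H : Type} [Field k] [CommRing H] [HopfAlgebra k H]

lemma antipode_antipode' (h : H) : HopfAlgebra.antipode k (HopfAlgebra.antipode k h) = h := by
  have h1 := eq_inv_of_mul_eq_one_right (AlgHom.antipode_id_cancel (R := k) (A := H))
  have h2 := congrArg (fun f => f.ofConv h) h1
  exact h2.symm

variable (k H) in
/-- The adjoint coaction as an algebra map `h ↦ h₂ ⊗ h₃ S(h₁)`. -/
def gam : H →ₐ[k] H ⊗[k] H :=
  WithConv.ofConv ((WithConv.toConv (Algebra.TensorProduct.includeRight (R := k) (A := H) (B := H)))⁻¹ *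
    WithConv.toConv (Algebra.TensorProduct.includeLeft (R := k) (S := k) (A := H) (B := H)) *
    WithConv.toConv (Algebra.TensorProduct.includeRight (R := k) (A := H) (B := H)))

variable (k H) in
def kap : (H ⊗[k] H) ⊗[k] H →ₗ[k] H ⊗[k] H :=
  TensorProduct.lift (TensorProduct.lift (LinearMap.mk₂ k
    (fun a b => (TensorProduct.mk k H H b).comp (LinearMap.mulRight k (HopfAlgebra.antipode k a)))
    (fun a a' b => by ext c; simp [mul_add, tmul_add])
    (fun r a b => by ext c; simp)
    (fun a b b' => by ext c; simp)
    (fun r a b => by ext c; simp [smul_tmul'])))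

@[simp] lemma kap_tmul (a b c : H) : kap k H ((a ⊗ₜ b) ⊗ₜ c) =
  b ⊗ₜ (c * HopfAlgebra.antipode k a) := by simp [kap]

lemma kap_Delta2 (h : H) : kap k H (Delta2 k H h) = gam k H h := by
  have : (kap k H) ∘ₗ (LinearMap.rTensor H (Coalgebra.comul (R := k) (A := H))) =
    (Algebra.TensorProduct.lift (WithConv.ofConv ((WithConv.toConv (Algebra.TensorProduct.includeRight (R := k) (A := H) (B := H)))⁻¹ *
    WithConv.toConv (Algebra.TensorProduct.includeLeft (R := k) (S := k) (A := H) (B := H))))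
     (Algebra.TensorProduct.includeRight (R := k) (A := H) (B := H)) (fun _ _ => .all _ _)).toLinearMap := by
    ext a c
    simp only [AlgebraTensorModule.curry_apply, LinearMap.restrictScalars_self, curry_apply,
      LinearMap.comp_apply, LinearMap.rTensor_tmul, AlgHom.toLinearMap_apply,
      Algebra.TensorProduct.lift_tmul]
    have e : (WithConv.ofConv ((WithConv.toConv (Algebra.TensorProduct.includeRight (R := k) (A := H) (B := H)))⁻¹ *
      WithConv.toConv (Algebra.TensorProduct.includeLeft (R := k) (S := k) (A := H) (B := H)))) a = _ :=
      AlgHom.convMul_apply _ _ a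
    rw [e]
    generalize (CoalgebraStruct.comul (R := k) a) = z
    induction z with
    | zero => simp
    | add x y hx hy => simp only [add_tmul, map_add, hx, hy, add_mul]
    | tmul x y =>
      simp [Inv.inv, mul_comm]
  have e2 : gam k H h = _ := AlgHom.convMul_apply _ _ h
  rw [e2]
  exact LinearMap.congr_fun this _

variable (k H) in
def muu : H ⊗[k] H →ₐ[k] H ⊗[k] H :=
  Algebra.TensorProduct.lift (gam k H)
    ((Algebra.TensorProduct.includeRight (R := k) (A := H) (B := H)).comp (HopfAlgebra.antipodeAlgHom k H))
    (fun _ _ => .all _ _)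

@[simp] lemma muu_tmul (a b : H) : muu k H (a ⊗ₜ b) = gam k H a * (1 ⊗ₜ HopfAlgebra.antipode k b) := by
  simp [muu]

lemma muu_gam (h : H) : muu k H (gam k H h) = h ⊗ₜ 1 := by
  have e : (muu k H).comp (gam k H) = Algebra.TensorProduct.includeLeft := by
    have a1 : (muu k H).comp (Algebra.TensorProduct.includeLeft) = gam k H := by
      ext; simp [← Algebra.TensorProduct.one_def]
    have a2 : WithConv.toConv ((muu k H).comp (Algebra.TensorProduct.includeRight)) =
       (WithConv.toConv (Algebra.TensorProduct.includeRight (R := k) (A := H) (B := H)))⁻¹ := by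
      apply WithConv.ofConv_injective
      ext x; simp [Inv.inv]
    have a3 : WithConv.toConv ((muu k H).comp ((Algebra.TensorProduct.includeRight (R := k) (A := H) (B := H)).comp (HopfAlgebra.antipodeAlgHom k H))) =
       (WithConv.toConv (Algebra.TensorProduct.includeRight (R := k) (A := H) (B := H))) := by
      apply WithConv.ofConv_injective
      ext x; simp [antipode_antipode']
    conv_lhs => rw [gam]
    rw [AlgHom.comp_convMul_distrib, AlgHom.comp_convMul_distrib, WithConv.toConv_ofConv, WithConv.ofConv_toConv, WithConv.ofConv_toConv, a1, a2]
    have a4 : WithConv.toConv ((muu k H).comp (WithConv.ofConv (WithConv.toConv (Algebra.TensorProduct.includeRight (R := k) (A := H) (B := H)))⁻¹)) =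
       (WithConv.toConv (Algebra.TensorProduct.includeRight (R := k) (A := H) (B := H))) := a3
    rw [a4, gam]
    have gg : ∀ (G : Type) [Group G] (x y : G), y * (y⁻¹ * x * y) * y⁻¹ = x := by
      intro G _ x y; group
    exact congrArg WithConv.ofConv (gg _ (WithConv.toConv
      (Algebra.TensorProduct.includeLeft (R := k) (S := k) (A := H) (B := H))) (WithConv.toConv
        (Algebra.TensorProduct.includeRight (R := k) (A := H) (B := H))))
  exact DFunLike.congr_fun e h

variable (k H) in
/-- `a ⊗ b ↦ S b ⊗ S a`. -/
def sw : H ⊗[k] H →ₐ[k] H ⊗[k] H :=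
  Algebra.TensorProduct.lift 
    ((Algebra.TensorProduct.includeRight (R := k) (A := H) (B := H)).comp (HopfAlgebra.antipodeAlgHom k H))
    ((Algebra.TensorProduct.includeLeft (R := k) (S := k) (A := H) (B := H)).comp (HopfAlgebra.antipodeAlgHom k H))
    (fun _ _ => .all _ _)

@[simp] lemma sw_tmul (a b : H) : sw k H (a ⊗ₜ b) =
   (HopfAlgebra.antipode k b) ⊗ₜ (HopfAlgebra.antipode k a) := by
  simp [sw]

lemma comul_antipode (h : H) : Coalgebra.comul (R := k) (HopfAlgebra.antipode k h) =
    sw k H (Coalgebra.comul (R := k) h) := by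
  have e : WithConv.toConv (Bialgebra.comulAlgHom k H) = WithConv.toConv (Algebra.TensorProduct.includeLeft (R := k) (S := k) (A := H) (B := H)) *
     WithConv.toConv (Algebra.TensorProduct.includeRight (R := k) (A := H) (B := H)) := by
    apply WithConv.ofConv_injective
    ext x
    have : (WithConv.ofConv (WithConv.toConv (Algebra.TensorProduct.includeLeft (R := k) (S := k) (A := H) (B := H)) *
     WithConv.toConv (Algebra.TensorProduct.includeRight (R := k) (A := H) (B := H)))) x = _ := AlgHom.convMul_apply _ _ x
    rw [this]
    simp
  have gg : ∀ (G : Type) [Group G] (x y : G), (x * y)⁻¹ = y⁻¹ * x⁻¹ := by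
    intro G _ x y; group
  have e2 := congrArg (fun f : WithConv (H →ₐ[k] H ⊗[k] H) => f.ofConv h)
    ((congrArg (·⁻¹) e).trans (gg (WithConv (H →ₐ[k] H ⊗[k] H)) (WithConv.toConv
      (Algebra.TensorProduct.includeLeft (R := k) (S := k) (A := H) (B := H))) (WithConv.toConv
        (Algebra.TensorProduct.includeRight (R := k) (A := H) (B := H)))))
  refine Eq.trans (Eq.trans ?_ e2) (Eq.trans (AlgHom.convMul_apply _ _ h) ?_)
  · rfl
  · rfl

end Main

section Main2
variable {k H : Type} [Field k] [CommRing H] [HopfAlgebra k H]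

lemma exists_nat_sum {V W : Type} [AddCommGroup V] [Module k V] [AddCommGroup W] [Module k W]
    (x : V ⊗[k] W) : ∃ (t : Finset ℕ) (v : ℕ → V) (w : ℕ → W), ∑ j ∈ t, v j ⊗ₜ[k] w j = x := by
  obtain ⟨n, v, w, h⟩ : ∃ (n : ℕ) (v : ℕ → V) (w : ℕ → W),
      ∑ j ∈ Finset.range n, v j ⊗ₜ[k] w j = x := by
    induction x with
    | zero => exact ⟨0, fun _ => 0, fun _ => 0, by simp⟩
    | tmul a b => exact ⟨1, fun _ => a, fun _ => b, by simp⟩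
    | add x y hx hy =>
      obtain ⟨n, v, w, h⟩ := hx
      obtain ⟨n', v', w', h'⟩ := hy
      refine ⟨n + n', fun i => if i < n then v i else v' (i - n),
        fun i => if i < n then w i else w' (i - n), ?_⟩
      rw [Finset.sum_range_add, ← h, ← h']
      congr 1
      · apply Finset.sum_congr rfl
        intro i hi
        simp [Finset.mem_range.1 hi]
      · apply Finset.sum_congr rfl
        intro i hi
        simp
  exact ⟨_, v, w, h⟩

section act
variable (M : Type) [AddCommGroup M] [Module k M] [Module H M] [IsScalarTower k H M]
  (R : Type) [CommRing R] [Algebra k R]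

/-- The action of `H ⊗ R` on `M ⊗ R`. -/
def act : H ⊗[k] R →ₐ[k] Module.End k (M ⊗[k] R) :=
  (Module.endTensorEndAlgHom (R := k) (S := k) (A := k) (M := M) (N := R)).comp
    (Algebra.TensorProduct.map (Algebra.lsmul k k M) (Algebra.lmul k R))

variable {M R}
@[simp] lemma act_tmul (a : H) (b : R) (m : M) (r : R) :
    act M R (a ⊗ₜ[k] b) (m ⊗ₜ[k] r) = (a • m) ⊗ₜ (b * r) := by
  simp [act, Module.endTensorEndAlgHom_apply]

lemma act_tmul_one (a : H) (x : M ⊗[k] R) : act M R (a ⊗ₜ[k] (1 : R)) x = a • x := by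
  induction x with
  | zero => simp
  | add x y hx hy => simp only [map_add, smul_add, hx, hy]
  | tmul m r => simp [smul_tmul']

lemma act_act (z w : H ⊗[k] R) (x : M ⊗[k] R) : act M R z (act M R w x) = act M R (z * w) x := by
  simp [map_mul]

end act

lemma compat_iff {Sinv : H →ₗ[k] H} (hS : ∀ h, Sinv h = HopfAlgebra.antipode k h)
    {M : Type} [AddCommGroup M] [Module k M] [Module H M] [IsScalarTower k H M]
    (ρ : M →ₗ[k] M ⊗[k] H) :
    IsYDCompat k H Sinv ρ ↔ ∀ h m, ρ (h • m) = act M H (gam k H h) (ρ m) := by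
  have key : ∀ (h : H) (m : M) (s t : Finset ℕ) (a b c : ℕ → H) (m₀ : ℕ → M) (m₁ : ℕ → H),
    (∑ i ∈ s, (a i ⊗ₜ[k] b i) ⊗ₜ[k] c i) = Delta2 k H h →
    (∑ j ∈ t, m₀ j ⊗ₜ[k] m₁ j) = ρ m →
    act M H (gam k H h) (ρ m) =
      ∑ i ∈ s, ∑ j ∈ t, (b i • m₀ j) ⊗ₜ[k] (c i * m₁ j * Sinv (a i)) := by
    intro h m s t a b c m₀ m₁ h1 h2
    rw [← kap_Delta2, ← h1, ← h2]
    simp only [map_sum, LinearMap.sum_apply, kap_tmul, act_tmul, hS]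
    rw [Finset.sum_comm]
    refine Finset.sum_congr rfl fun i _ => Finset.sum_congr rfl fun j _ => ?_
    congr 1
    ring
  constructor
  · intro hc h m
    obtain ⟨t, m₀, m₁, h2⟩ := exists_nat_sum (ρ m)
    obtain ⟨s, ab, c, h1⟩ := exists_nat_sum (Delta2 k H h)
    have : ∃ (n : Finset ℕ) (a b c : ℕ → H),
        ∑ i ∈ n, (a i ⊗ₜ[k] b i) ⊗ₜ[k] c i = Delta2 k H h := by
      generalize Delta2 k H h = z
      obtain ⟨n, a, b, c, h⟩ : ∃ (n : ℕ) (a b c : ℕ → H),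
        ∑ i ∈ Finset.range n, (a i ⊗ₜ[k] b i) ⊗ₜ[k] c i = z := by
        have hadd : ∀ x y : (H ⊗[k] H) ⊗[k] H, 
          (∃ (n : ℕ) (a b c : ℕ → H), ∑ i ∈ Finset.range n, (a i ⊗ₜ[k] b i) ⊗ₜ[k] c i = x) →
          (∃ (n : ℕ) (a b c : ℕ → H), ∑ i ∈ Finset.range n, (a i ⊗ₜ[k] b i) ⊗ₜ[k] c i = y) →
          (∃ (n : ℕ) (a b c : ℕ → H), ∑ i ∈ Finset.range n, (a i ⊗ₜ[k] b i) ⊗ₜ[k] c i = x + y) := by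
          rintro x y ⟨n, a, b, c, h⟩ ⟨n', a', b', c', h'⟩
          refine ⟨n + n', fun i => if i < n then a i else a' (i - n),
            fun i => if i < n then b i else b' (i - n),
            fun i => if i < n then c i else c' (i - n), ?_⟩
          rw [Finset.sum_range_add, ← h, ← h']
          congr 1
          · apply Finset.sum_congr rfl
            intro i hi
            simp [Finset.mem_range.1 hi]
          · apply Finset.sum_congr rfl
            intro i hi
            simp
        induction z with
        | zero => exact ⟨0, fun _ => 0, fun _ => 0, fun _ => 0, by simp⟩
        | add x y hx hy => exact hadd x y hx hy
        | tmul x c =>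
          induction x with
          | zero => exact ⟨0, fun _ => 0, fun _ => 0, fun _ => 0, by simp⟩
          | add x y hx hy => rw [add_tmul]; exact hadd _ _ hx hy
          | tmul a b => exact ⟨1, fun _ => a, fun _ => b, fun _ => c, by simp⟩
      exact ⟨_, a, b, c, h⟩
    obtain ⟨s, a, b, c, h1⟩ := this
    rw [key h m s t a b c m₀ m₁ h1 h2]
    exact hc h m s t a b c m₀ m₁ h1 h2
  · intro hc h m s t a b c m₀ m₁ h1 h2
    rw [hc, key h m s t a b c m₀ m₁ h1 h2]

section tens
variable (M N : Type) [AddCommGroup M] [Module k M] [Module H M] [IsScalarTower k H M]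
  [SMulCommClass H k M]
  [AddCommGroup N] [Module k N] [Module H N] [IsScalarTower k H N] [SMulCommClass H k N]
  (R : Type) [CommRing R] [Algebra k R]

/-- `(m ⊗ n) ↦ m ⊗_H n` as a `k`-bilinear map. -/
def mkHk : M →ₗ[k] N →ₗ[k] M ⊗[H] N :=
  LinearMap.mk₂ k (fun m n => m ⊗ₜ[H] n) (fun _ _ _ => add_tmul _ _ _) 
    (fun _ _ _ => by rw [smul_tmul']) (fun _ _ _ => tmul_add _ _ _)
    (fun c m n => by rw [← algebraMap_smul H c n, tmul_smul, algebraMap_smul])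

/-- `(m ⊗ a, n ⊗ b) ↦ (m ⊗ n) ⊗ (b a)`. -/
def mm : M ⊗[k] R →ₗ[k] N ⊗[k] R →ₗ[k] (M ⊗[H] N) ⊗[k] R :=
  TensorProduct.map₂ (mkHk (k := k) (H := H) M N) (LinearMap.mul k R)

variable {M N R}
@[simp] lemma mm_tmul (m : M) (n : N) (a b : R) :
    mm (H := H) M N R (m ⊗ₜ[k] a) (n ⊗ₜ[k] b) = (m ⊗ₜ[H] n) ⊗ₜ[k] (a * b) := by
  simp [mm, mkHk]

lemma mm_act_left (z : H ⊗[k] R) (x : M ⊗[k] R) (y : N ⊗[k] R) :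
    mm (H := H) M N R (act M R z x) y = act (M ⊗[H] N) R z (mm M N R x y) := by
  induction z with
  | zero => simp
  | add z w hz hw => simp only [map_add, LinearMap.add_apply, hz, hw]
  | tmul a b =>
    induction x with
    | zero => simp
    | add z w hz hw => simp only [map_add, LinearMap.add_apply, hz, hw]
    | tmul m r =>
      induction y with
      | zero => simp
      | add z w hz hw => simp only [map_add, hz, hw]
      | tmul n s => simp [smul_tmul', mul_assoc]

lemma mm_act_right (z : H ⊗[k] R) (x : M ⊗[k] R) (y : N ⊗[k] R) :
    mm (H := H) M N R x (act N R z y) = act (M ⊗[H] N) R z (mm M N R x y) := by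
  induction z with
  | zero => simp
  | add z w hz hw => simp only [map_add, LinearMap.add_apply, hz, hw]
  | tmul a b =>
    induction x with
    | zero => simp
    | add z w hz hw => simp only [map_add, LinearMap.add_apply, hz, hw]
    | tmul m r =>
      induction y with
      | zero => simp
      | add z w hz hw => simp only [map_add, hz, hw]
      | tmul n s => simp [mul_left_comm]

variable (ρM : M →ₗ[k] M ⊗[k] H) (ρN : N →ₗ[k] N ⊗[k] H)
  (hM : ∀ (h : H) m, ρM (h • m) = act M H (gam k H h) (ρM m))
  (hN : ∀ (h : H) m, ρN (h • m) = act N H (gam k H h) (ρN m))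

/-- The coaction on `M ⊗_H N`, as an additive map. -/
def tcoAdd : (M ⊗[H] N) →+ (M ⊗[H] N) ⊗[k] H :=
  TensorProduct.liftAddHom
    { toFun := fun m => ((mm (H := H) M N H (ρM m)) ∘ₗ ρN).toAddMonoidHom
      map_zero' := by ext; simp
      map_add' := fun x y => by ext; simp } (fun h m n => by
        simp [hM, hN, mm_act_left, mm_act_right])

lemma tcoAdd_tmul (m : M) (n : N) :
   tcoAdd ρM ρN hM hN (m ⊗ₜ n) = mm M N H (ρM m) (ρN n) := rfl

lemma tcoAdd_smul (c : k) (x : M ⊗[H] N) :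
   tcoAdd ρM ρN hM hN (c • x) = c • tcoAdd ρM ρN hM hN x := by
  induction x with
  | zero => rw [smul_zero, map_zero, smul_zero]
  | add x y hx hy => rw [smul_add, map_add, hx, hy, map_add, smul_add]
  | tmul m n => rw [smul_tmul', tcoAdd_tmul, tcoAdd_tmul, map_smul, map_smul, LinearMap.smul_apply]

/-- The coaction on `M ⊗_H N`. -/
def tco : (M ⊗[H] N) →ₗ[k] (M ⊗[H] N) ⊗[k] H where
  toFun := tcoAdd ρM ρN hM hN
  map_add' x y := map_add _ x y
  map_smul' c x := tcoAdd_smul ρM ρN hM hN c x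

@[simp] lemma tco_tmul (m : M) (n : N) :
   tco ρM ρN hM hN (m ⊗ₜ n) = mm M N H (ρM m) (ρN n) := rfl

lemma tco_compat (h : H) (x : M ⊗[H] N) : tco ρM ρN hM hN (h • x) =
    act (M ⊗[H] N) H (gam k H h) (tco ρM ρN hM hN x) := by
  induction x with
  | zero => simp
  | add x y hx hy => simp only [smul_add, map_add, hx, hy]
  | tmul m n => simp [smul_tmul', hM, mm_act_left]


lemma tco_comod (cM : IsComod k H ρM) (cN : IsComod k H ρN) :
    IsComod k H (tco ρM ρN hM hN) := by
  constructor
  · intro x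
    induction x with
    | zero => simp
    | add x y hx hy => simp only [map_add, hx, hy]
    | tmul m n =>
      have : ∀ (x : M ⊗[k] H) (y : N ⊗[k] H), (TensorProduct.rid k (M ⊗[H] N))
        ((LinearMap.lTensor (M ⊗[H] N) (Coalgebra.counit (R := k) (A := H))) (mm M N H x y)) =
        (TensorProduct.rid k M)
          ((LinearMap.lTensor M (Coalgebra.counit (R := k) (A := H))) x) ⊗ₜ[H]
        (TensorProduct.rid k N)
          ((LinearMap.lTensor N (Coalgebra.counit (R := k) (A := H))) y) := by
        intro x y
        induction x with
        | zero => simp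
        | add z w hz hw => simp only [map_add, LinearMap.add_apply, hz, hw, add_tmul]
        | tmul m r =>
          induction y with
          | zero => simp
          | add z w hz hw => simp only [map_add, hz, hw, tmul_add]
          | tmul n s =>
            simp only [mm_tmul, LinearMap.lTensor_tmul, TensorProduct.rid_tmul,
              Bialgebra.counit_mul]
            rw [← algebraMap_smul H (Coalgebra.counit s) n, tmul_smul, algebraMap_smul,
              ← smul_tmul', smul_smul, mul_comm]
      rw [tco_tmul, this, cM.1, cN.1]
  · intro x
    induction x with
    | zero => simp
    | add x y hx hy => simp only [map_add, hx, hy]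
    | tmul m n =>
      have h1 : ∀ (x : M ⊗[k] H) (y : N ⊗[k] H),
          (LinearMap.lTensor (M ⊗[H] N) (Coalgebra.comul (R := k) (A := H))) (mm M N H x y) =
          mm M N (H ⊗[k] H) ((LinearMap.lTensor M (Coalgebra.comul (R := k) (A := H))) x)
            ((LinearMap.lTensor N (Coalgebra.comul (R := k) (A := H))) y) := by
        intro x y
        induction x with
        | zero => simp
        | add z w hz hw => simp only [map_add, LinearMap.add_apply, hz, hw]
        | tmul m r =>
          induction y with
          | zero => simp
          | add z w hz hw => simp only [map_add, hz, hw]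
          | tmul n s => simp
      have h2 : ∀ (x : M ⊗[k] H) (y : N ⊗[k] H) (a b : H),
          (TensorProduct.assoc k _ H H) ((mm (H := H) M N H x y) ⊗ₜ[k] (a * b)) =
          mm M N (H ⊗[k] H) (TensorProduct.assoc k _ H H (x ⊗ₜ a))
            (TensorProduct.assoc k _ H H (y ⊗ₜ b)) := by
        intro x y a b
        induction x with
        | zero => simp
        | add z w hz hw => simp only [map_add, LinearMap.add_apply, add_tmul, hz, hw]
        | tmul m r =>
          induction y with
          | zero => simp
          | add z w hz hw => simp only [map_add, hz, hw, add_tmul]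
          | tmul n s => simp
      have h3 : ∀ (x : M ⊗[k] H) (y : N ⊗[k] H),
          (TensorProduct.assoc k _ H H) ((LinearMap.rTensor H (tco ρM ρN hM hN)) (mm M N H x y)) =
          mm M N (H ⊗[k] H) (TensorProduct.assoc k _ H H (LinearMap.rTensor H ρM x))
            (TensorProduct.assoc k _ H H (LinearMap.rTensor H ρN y)) := by
        intro x y
        induction x with
        | zero => simp
        | add z w hz hw => simp only [map_add, LinearMap.add_apply, hz, hw]
        | tmul m r =>
          induction y with
          | zero => simp
          | add z w hz hw => simp only [map_add, hz, hw]
          | tmul n s => simp [h2]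
      rw [tco_tmul, h1, h3, cM.2, cN.2]

lemma char_eq {Sinv : H →ₗ[k] H} (A B : YDCat k H Sinv)
    (hM : ∀ (h : H) m, A.ρ (h • m) = act A.M H (gam k H h) (A.ρ m))
    (hN : ∀ (h : H) m, B.ρ (h • m) = act B.M H (gam k H h) (B.ρ m))
    (ρT : (A.M ⊗[H] B.M) →ₗ[k] (A.M ⊗[H] B.M) ⊗[k] H) (hT : TensorCoactChar Sinv A B ρT) :
    ρT = tco A.ρ B.ρ hM hN := by
  apply LinearMap.ext
  intro x
  induction x with
  | zero => simp
  | add x y hx hy => simp only [map_add, hx, hy]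
  | tmul m n =>
    obtain ⟨s, m₀, m₁, h1⟩ := exists_nat_sum (A.ρ m)
    obtain ⟨t, n₀, n₁, h2⟩ := exists_nat_sum (B.ρ n)
    rw [hT m n s t m₀ m₁ n₀ n₁ h1 h2, tco_tmul, ← h1, ← h2]
    simp only [map_sum, LinearMap.sum_apply, mm_tmul]
    rw [Finset.sum_comm]
    refine Finset.sum_congr rfl fun i _ => Finset.sum_congr rfl fun j _ => ?_
    rw [mul_comm]

end tens
end Main2

section Main3
variable {k H : Type} [Field k] [CommRing H] [HopfAlgebra k H]

section thet
variable {N B : Type} [AddCommGroup N] [Module k N]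
  [AddCommGroup B] [Module k B] [Module H B] [IsScalarTower k H B]
  {R : Type} [CommRing R] [Algebra k R] {W : Type} [AddCommGroup W] [Module k W]

variable (k H B R) in
/-- right multiplication `b ⊗ r' ↦ b ⊗ r r'`. -/
def rm : R →ₗ[k] Module.End k (B ⊗[k] R) :=
  (act (k := k) (H := H) B R).toLinearMap ∘ₗ (TensorProduct.mk k H R 1)

lemma rm_apply (r : R) (x : B ⊗[k] R) : rm k H B R r x = act B R ((1 : H) ⊗ₜ[k] r) x := rfl

@[simp] lemma rm_tmul (r r' : R) (b : B) : rm k H B R r (b ⊗ₜ r') = b ⊗ₜ (r * r') := by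
  simp [rm]

lemma rm_rm (r r' : R) (x : B ⊗[k] R) : rm k H B R r (rm k H B R r' x) = rm k H B R (r * r') x := by
  simp [rm_apply, act_act]

lemma rm_algebraMap (c : k) (x : B ⊗[k] R) : rm k H B R (algebraMap k R c) x = c • x := by
  rw [Algebra.algebraMap_eq_smul_one, map_smul, LinearMap.smul_apply, rm_apply,
    ← Algebra.TensorProduct.one_def, map_one]
  rfl

variable (H) in
/-- `n ⊗ w ↦ φ(n) σ(w)`. -/
def thet (σ : W →ₗ[k] R) (φ : N →ₗ[k] B ⊗[k] R) : N ⊗[k] W →ₗ[k] B ⊗[k] R :=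
  TensorProduct.lift ((rm k H B R ∘ₗ σ).flip ∘ₗ φ)

@[simp] lemma thet_tmul (σ : W →ₗ[k] R) (φ : N →ₗ[k] B ⊗[k] R) (n : N) (w : W) :
    thet H σ φ (n ⊗ₜ w) = rm k H B R (σ w) (φ n) := by
  simp [thet]

lemma thet_add (σ : W →ₗ[k] R) (φ φ' : N →ₗ[k] B ⊗[k] R) :
    thet H σ (φ + φ') = thet H σ φ + thet H σ φ' := by
  ext n w; simp

lemma thet_smul (σ : W →ₗ[k] R) (c : k) (φ : N →ₗ[k] B ⊗[k] R) :
    thet H σ (c • φ) = c • thet H σ φ := by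
  ext n w; simp

lemma thet_thet {ρN : N →ₗ[k] N ⊗[k] H} (cN : IsComod k H ρN) (σ τ : H →ₗ[k] H)
    (hst : ∀ h : H, LinearMap.mul' k H (TensorProduct.map τ σ (Coalgebra.comul (R := k) h)) =
      algebraMap k H (Coalgebra.counit h))
    (φ : N →ₗ[k] B ⊗[k] H) (n : N) :
    thet H σ (thet H τ φ ∘ₗ ρN) (ρN n) = φ n := by
  have h1 : ∀ y : N ⊗[k] H, thet H σ (thet H τ φ ∘ₗ ρN) y =
      thet H (LinearMap.mul' k H ∘ₗ TensorProduct.map τ σ) φ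
        (TensorProduct.assoc k N H H (LinearMap.rTensor H ρN y)) := by
    intro y
    induction y with
    | zero => simp
    | add x y hx hy => simp only [map_add, hx, hy]
    | tmul n h =>
      simp only [thet_tmul, LinearMap.comp_apply, LinearMap.rTensor_tmul]
      generalize ρN n = w
      induction w with
      | zero => simp
      | add x y hx hy => simp only [map_add, hx, hy, add_tmul]
      | tmul n' b => simp [rm_rm, mul_comm]
  have h2 : ∀ y : N ⊗[k] H, thet H (LinearMap.mul' k H ∘ₗ TensorProduct.map τ σ) φ
      (LinearMap.lTensor N (Coalgebra.comul (R := k) (A := H)) y) =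
      φ (TensorProduct.rid k N (LinearMap.lTensor N (Coalgebra.counit (R := k) (A := H)) y)) := by
    intro y
    induction y with
    | zero => simp
    | add x y hx hy => simp only [map_add, hx, hy]
    | tmul n h =>
      simp only [LinearMap.lTensor_tmul, thet_tmul, LinearMap.comp_apply, hst, rm_algebraMap,
        TensorProduct.rid_tmul, map_smul]
  rw [h1, cN.2, h2, cN.1]

end thet

section hom
variable {N B : Type} [AddCommGroup N] [Module k N] [Module H N] [IsScalarTower k H N]
  [SMulCommClass H k N]
  [AddCommGroup B] [Module k B] [Module H B] [IsScalarTower k H B] [SMulCommClass H k B]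

lemma exists_dual (hf : Module.Finite H N) (hp : Module.Projective H N) :
    ∃ (n : ℕ) (x : Fin n → N) (φ : Fin n → (N →ₗ[H] H)), ∀ y, ∑ i, φ i y • x i = y := by
  obtain ⟨n, f, hf⟩ := Module.Finite.exists_fin' H N
  obtain ⟨g, hg⟩ := LinearMap.exists_rightInverse_of_surjective f (LinearMap.range_eq_top.2 hf)
  refine ⟨n, fun i => f (Pi.single i 1), fun i => (LinearMap.proj i) ∘ₗ g, fun y => ?_⟩
  have h1 : f (g y) = y := LinearMap.congr_fun hg y
  conv_rhs => rw [← h1, ← Finset.univ_sum_single (g y)]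
  rw [map_sum]
  refine Finset.sum_congr rfl fun i _ => ?_
  simp only [LinearMap.comp_apply, LinearMap.proj_apply]
  rw [← map_smul]
  congr 1
  ext j
  simp [Pi.single_apply]

/-- `b ↦ φ(-) b`. -/
def cc (φ : N →ₗ[H] H) : B →ₗ[k] (N →ₗ[H] B) where
  toFun b := φ.smulRight b
  map_add' b b' := by ext; simp
  map_smul' c b := by
    ext n
    simp only [LinearMap.smulRight_apply, LinearMap.smul_apply, RingHom.id_apply]
    exact smul_comm _ _ _

lemma ev_inj (hf : Module.Finite H N) (hp : Module.Projective H N)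
    {W : Type} [AddCommGroup W] [Module k W] (x y : (N →ₗ[H] B) ⊗[k] W)
    (h : ∀ n : N, LinearMap.rTensor W (evalAtH (k := k) (N := B) n) x =
      LinearMap.rTensor W (evalAtH (N := B) n) y) : x = y := by
  obtain ⟨d, e, φ, he⟩ := exists_dual hf hp
  have key : ∀ x : (N →ₗ[H] B) ⊗[k] W, ∑ i, LinearMap.rTensor W (cc (B := B) (φ i))
      (LinearMap.rTensor W (evalAtH (k := k) (N := B) (e i)) x) = x := by
    intro x
    induction x with
    | zero => simp
    | add x y hx hy => simp only [map_add, Finset.sum_add_distrib, hx, hy]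
    | tmul f w =>
      simp only [LinearMap.rTensor_tmul, ← sum_tmul]
      congr 1
      ext n
      simp only [LinearMap.sum_apply, cc, evalAtH, LinearMap.coe_mk, AddHom.coe_mk,
        LinearMap.smulRight_apply]
      simp only [← map_smul, ← map_sum, he]
  rw [← key x, ← key y]
  simp only [h]

variable (ρN : N →ₗ[k] N ⊗[k] H) (ρB : B →ₗ[k] B ⊗[k] H)

/-- `f ↦ f(n₀)₀ ⊗ f(n₀)₁ S(n₁)` -/
def DD (n : N) : (N →ₗ[H] B) →ₗ[k] B ⊗[k] H where
  toFun f := thet H (HopfAlgebra.antipode k) (ρB ∘ₗ f.restrictScalars k) (ρN n)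
  map_add' f g := by
    rw [← LinearMap.add_apply, ← thet_add, ← LinearMap.comp_add]; rfl
  map_smul' c f := by
    rw [RingHom.id_apply, ← LinearMap.smul_apply, ← thet_smul, ← LinearMap.comp_smul]; rfl

lemma DD_apply (n : N) (f : N →ₗ[H] B) : DD ρN ρB n f =
  thet H (HopfAlgebra.antipode k) (ρB ∘ₗ f.restrictScalars k) (ρN n) := rfl

lemma DD_smul (hN : ∀ (h : H) m, ρN (h • m) = act N H (gam k H h) (ρN m))
    (hB : ∀ (h : H) m, ρB (h • m) = act B H (gam k H h) (ρB m)) (h : H) (n : N)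
    (f : N →ₗ[H] B) : DD ρN ρB (h • n) f = h • DD ρN ρB n f := by
  have key : ∀ (z : H ⊗[k] H) (y : N ⊗[k] H),
      thet H (HopfAlgebra.antipode k) (ρB ∘ₗ f.restrictScalars k) (act N H z y) =
      act B H (muu k H z) (thet H (HopfAlgebra.antipode k) (ρB ∘ₗ f.restrictScalars k) y) := by
    intro z y
    induction z with
    | zero => simp
    | add x y hx hy => simp only [map_add, LinearMap.add_apply, hx, hy]
    | tmul a b =>
      induction y with
      | zero => simp
      | add x y hx hy => simp only [map_add, hx, hy]
      | tmul n c =>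
        simp only [act_tmul, thet_tmul, LinearMap.comp_apply, LinearMap.restrictScalars_apply,
          map_smul, hB, rm_apply, act_act, muu_tmul, HopfAlgebra.antipode_mul_distrib]
        congr 2
        rw [mul_assoc, Algebra.TensorProduct.tmul_mul_tmul, mul_one, mul_comm]
  rw [DD_apply, hN, key, muu_gam, act_tmul_one, DD_apply]

lemma exists_hom_coact (hf : Module.Finite H N) (hp : Module.Projective H N)
    (hN : ∀ (h : H) m, ρN (h • m) = act N H (gam k H h) (ρN m))
    (hB : ∀ (h : H) m, ρB (h • m) = act B H (gam k H h) (ρB m)) :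
    ∃ ρ' : (N →ₗ[H] B) →ₗ[k] (N →ₗ[H] B) ⊗[k] H, ∀ f n,
      LinearMap.rTensor H (evalAtH (N := B) n) (ρ' f) = DD ρN ρB n f := by
  obtain ⟨d, e, φ, he⟩ := exists_dual hf hp
  refine ⟨∑ i, LinearMap.rTensor H (cc (B := B) (φ i)) ∘ₗ DD ρN ρB (e i), fun f n => ?_⟩
  simp only [LinearMap.sum_apply, LinearMap.comp_apply, map_sum]
  have key : ∀ (i) (z : B ⊗[k] H), LinearMap.rTensor H (evalAtH (k := k) (N := B) n)
      (LinearMap.rTensor H (cc (B := B) (φ i)) z) = φ i n • z := by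
    intro i z
    induction z with
    | zero => simp
    | add x y hx hy => simp only [map_add, smul_add, hx, hy]
    | tmul b h => simp [cc, evalAtH, smul_tmul']
  simp only [key, ← DD_smul ρN ρB hN hB]
  conv_rhs => rw [← he n]
  have : ∀ (s : Finset (Fin d)) (v : Fin d → N), DD ρN ρB (∑ i ∈ s, v i) f = ∑ i ∈ s, DD ρN ρB (v i) f := by
    intro s v
    simp [DD_apply]
  rw [this]

variable {ρN ρB} (ρ' : (N →ₗ[H] B) →ₗ[k] (N →ₗ[H] B) ⊗[k] H)

lemma hom_compat
    (hρ' : ∀ f n, LinearMap.rTensor H (evalAtH (N := B) n) (ρ' f) = DD ρN ρB n f)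
    (hf : Module.Finite H N) (hp : Module.Projective H N)
    (hB : ∀ (h : H) m, ρB (h • m) = act B H (gam k H h) (ρB m)) (h : H) (f : N →ₗ[H] B) :
    ρ' (h • f) = act (N →ₗ[H] B) H (gam k H h) (ρ' f) := by
  apply ev_inj hf hp
  intro n
  have key : ∀ (z : H ⊗[k] H) (y : (N →ₗ[H] B) ⊗[k] H),
      LinearMap.rTensor H (evalAtH (N := B) n) (act (N →ₗ[H] B) H z y) =
      act B H z (LinearMap.rTensor H (evalAtH (N := B) n) y) := by
    intro z y
    induction z with
    | zero => simp
    | add x y hx hy => simp only [map_add, LinearMap.add_apply, hx, hy]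
    | tmul a b =>
      induction y with
      | zero => simp
      | add x y hx hy => simp only [map_add, hx, hy]
      | tmul n c => simp [evalAtH]
  rw [key, hρ', hρ', DD_apply, DD_apply]
  generalize ρN n = y
  induction y with
  | zero => simp
  | add x y hx hy => simp only [map_add, hx, hy]
  | tmul n c =>
    simp only [thet_tmul, LinearMap.comp_apply, LinearMap.restrictScalars_apply,
      LinearMap.smul_apply, hB, rm_apply, act_act]
    rw [mul_comm]

lemma hom_comod
    (hρ' : ∀ f n, LinearMap.rTensor H (evalAtH (N := B) n) (ρ' f) = DD ρN ρB n f)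
    (hf : Module.Finite H N) (hp : Module.Projective H N)
    (cN : IsComod k H ρN) (cB : IsComod k H ρB) : IsComod k H ρ' := by
  constructor
  · intro f
    ext n
    have h1 : ∀ y : (N →ₗ[H] B) ⊗[k] H, (TensorProduct.rid k (N →ₗ[H] B)
        (LinearMap.lTensor _ (Coalgebra.counit (R := k) (A := H)) y)) n =
        TensorProduct.rid k B (LinearMap.lTensor _ (Coalgebra.counit (R := k) (A := H))
          (LinearMap.rTensor H (evalAtH (N := B) n) y)) := by
      intro y
      induction y with
      | zero => simp
      | add x y hx hy => simp only [map_add, LinearMap.add_apply, hx, hy]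
      | tmul f h => simp [evalAtH]
    have h2 : ∀ y : N ⊗[k] H, TensorProduct.rid k B
        (LinearMap.lTensor _ (Coalgebra.counit (R := k) (A := H))
          (thet H (HopfAlgebra.antipode k) (ρB ∘ₗ f.restrictScalars k) y)) =
        f (TensorProduct.rid k N (LinearMap.lTensor _ (Coalgebra.counit (R := k) (A := H)) y)) := by
      intro y
      induction y with
      | zero => simp
      | add x y hx hy => simp only [map_add, hx, hy]
      | tmul n h =>
        have h3 : ∀ z : B ⊗[k] H, TensorProduct.rid k B
          (LinearMap.lTensor _ (Coalgebra.counit (R := k) (A := H)) 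
            (rm k H B H (HopfAlgebra.antipode k h) z)) =
          Coalgebra.counit (R := k) h • TensorProduct.rid k B
          (LinearMap.lTensor _ (Coalgebra.counit (R := k) (A := H)) z) := by
          intro z
          induction z with
          | zero => simp
          | add x y hx hy => simp only [map_add, hx, hy, smul_add]
          | tmul b h => simp [mul_smul]
        have h4 : f (Coalgebra.counit (R := k) h • n) = Coalgebra.counit (R := k) h • f n :=
          (f.restrictScalars k).map_smul _ _
        simp [h3, cB.1, h4]
    rw [h1, hρ', DD_apply, h2, cN.1]
  · intro f
    apply ev_inj hf hp
    intro n
    have h1 : ∀ y : (N →ₗ[H] B) ⊗[k] H,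
       LinearMap.rTensor (H ⊗[k] H) (evalAtH (N := B) n)
        (LinearMap.lTensor _ (Coalgebra.comul (R := k) (A := H)) y) =
        LinearMap.lTensor _ (Coalgebra.comul (R := k) (A := H))
          (LinearMap.rTensor H (evalAtH (N := B) n) y) := by
      intro y
      induction y with
      | zero => simp
      | add x y hx hy => simp only [map_add, hx, hy]
      | tmul f h => simp
    have h2 : ∀ y : N ⊗[k] H, LinearMap.lTensor _ (Coalgebra.comul (R := k) (A := H))
          (thet H (HopfAlgebra.antipode k) (ρB ∘ₗ f.restrictScalars k) y) =
        thet H (sw k H).toLinearMap (LinearMap.lTensor _ (Coalgebra.comul (R := k) (A := H)) ∘ₗ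
          (ρB ∘ₗ f.restrictScalars k)) (LinearMap.lTensor _ (Coalgebra.comul (R := k) (A := H)) y) := by
      intro y
      induction y with
      | zero => simp
      | add x y hx hy => simp only [map_add, hx, hy]
      | tmul n h =>
        simp only [thet_tmul, LinearMap.lTensor_tmul, AlgHom.toLinearMap_apply, ← comul_antipode,
          LinearMap.comp_apply]
        generalize ρB _ = z
        induction z with
        | zero => simp
        | add x y hx hy => simp only [map_add, hx, hy]
        | tmul b h' => simp
    have h3 : ∀ y : (N →ₗ[H] B) ⊗[k] H,
       LinearMap.rTensor (H ⊗[k] H) (evalAtH (N := B) n)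
        (TensorProduct.assoc k _ H H (LinearMap.rTensor H ρ' y)) =
        TensorProduct.assoc k _ H H (LinearMap.rTensor H (DD ρN ρB n) y) := by
      intro y
      induction y with
      | zero => simp
      | add x y hx hy => simp only [map_add, hx, hy]
      | tmul f h =>
        simp only [LinearMap.rTensor_tmul, ← hρ']
        generalize ρ' f = z
        induction z with
        | zero => simp
        | add x y hx hy => simp only [map_add, hx, hy, add_tmul]
        | tmul b h' => simp
    -- step: expand DD
    have h4 : ∀ (w : N ⊗[k] H) (L : (N →ₗ[H] B) →ₗ[k] B ⊗[k] H),
        (∀ g : N →ₗ[H] B, L g = thet H (HopfAlgebra.antipode k) (ρB ∘ₗ g.restrictScalars k) w) →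
        TensorProduct.assoc k _ H H (LinearMap.rTensor H L (ρ' f)) =
        thet H (sw k H).toLinearMap ((TensorProduct.assoc k B H H).toLinearMap ∘ₗ LinearMap.rTensor H ρB ∘ₗ
          (ρB ∘ₗ f.restrictScalars k)) (TensorProduct.assoc k _ H H (LinearMap.rTensor H ρN w)) := by
      intro w
      induction w with
      | zero =>
        intro L hL
        have : L = 0 := by ext1 g; rw [hL]; simp
        simp [this]
      | add x y hx hy =>
        intro L hL
        let Lx : (N →ₗ[H] B) →ₗ[k] B ⊗[k] H :=
          { toFun := fun f => thet H (HopfAlgebra.antipode k) (ρB ∘ₗ f.restrictScalars k) x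
            map_add' := fun f g => by
              rw [← LinearMap.add_apply, ← thet_add, ← LinearMap.comp_add]; rfl
            map_smul' := fun c f => by
              rw [RingHom.id_apply, ← LinearMap.smul_apply, ← thet_smul, ← LinearMap.comp_smul]; rfl }
        let Ly : (N →ₗ[H] B) →ₗ[k] B ⊗[k] H :=
          { toFun := fun f => thet H (HopfAlgebra.antipode k) (ρB ∘ₗ f.restrictScalars k) y
            map_add' := fun f g => by
              rw [← LinearMap.add_apply, ← thet_add, ← LinearMap.comp_add]; rfl
            map_smul' := fun c f => by
              rw [RingHom.id_apply, ← LinearMap.smul_apply, ← thet_smul, ← LinearMap.comp_smul]; rfl }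
        have : L = Lx + Ly := by ext1 g; rw [hL, map_add]; rfl
        rw [this, LinearMap.rTensor_add, LinearMap.add_apply, map_add, hx Lx (fun _ => rfl),
          hy Ly (fun _ => rfl), map_add, map_add, map_add]
      | tmul n' h =>
        intro L hL
        have e1 : L = rm k H B H (HopfAlgebra.antipode k h) ∘ₗ ρB ∘ₗ evalAtH (N := B) n' := by
          ext1 g; rw [hL, thet_tmul]; rfl
        have e2 : LinearMap.rTensor H L (ρ' f) =
          LinearMap.rTensor H (rm k H B H (HopfAlgebra.antipode k h))
            (LinearMap.rTensor H ρB (DD ρN ρB n' f)) := by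
          rw [e1, LinearMap.rTensor_comp, LinearMap.rTensor_comp, LinearMap.comp_apply,
            LinearMap.comp_apply, hρ']
        rw [e2, DD_apply, LinearMap.rTensor_tmul]
        generalize ρN n' = z
        induction z with
        | zero => simp
        | add x y hx hy => simp only [map_add, hx, hy, add_tmul]
        | tmul n'' h' =>
          simp only [thet_tmul, TensorProduct.assoc_tmul, AlgHom.toLinearMap_apply, sw_tmul,
            LinearMap.comp_apply, LinearMap.restrictScalars_apply, LinearEquiv.coe_coe]
          generalize ρB (f n'') = v
          induction v with
          | zero => simp
          | add x y hx hy => simp only [map_add, hx, hy]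
          | tmul b c =>
            simp only [rm_tmul, LinearMap.rTensor_tmul]
            generalize ρB b = u
            induction u with
            | zero => simp
            | add x y hx hy => simp only [map_add, hx, hy, add_tmul]
            | tmul b c => simp
    rw [h1, h3, hρ', DD_apply, h2, ← cN.2, h4 (ρN n) (DD ρN ρB n) (fun g => rfl)]
    congr 2
    ext n'
    exact cB.2 _

end hom
end Main3

section Main4
variable {k H : Type} [Field k] [CommRing H] [HopfAlgebra k H] {Sinv : H →ₗ[k] H}

lemma YDCat.act_compat (hS : ∀ h, Sinv h = HopfAlgebra.antipode k h) (A : YDCat k H Sinv) :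
    ∀ (h : H) m, A.ρ (h • m) = act A.M H (gam k H h) (A.ρ m) :=
  (compat_iff hS A.ρ).1 A.compat

/-- The tensor product of Yetter-Drinfeld modules. -/
def tensYD (hS : ∀ h, Sinv h = HopfAlgebra.antipode k h) (A B : YDCat k H Sinv) :
    YDCat k H Sinv :=
  YDCat.mk (M := A.M ⊗[H] B.M) (tco A.ρ B.ρ (A.act_compat hS) (B.act_compat hS))
    (tco_comod _ _ _ _ A.comod B.comod) ((compat_iff hS _).2 (tco_compat _ _ _ _))

lemma IsHom.apply {A B : Type} [AddCommGroup A] [Module k A] [Module H A]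
    [AddCommGroup B] [Module k B] [Module H B]
    {ρA : A →ₗ[k] A ⊗[k] H} {ρB : B →ₗ[k] B ⊗[k] H} {f : A →ₗ[k] B}
    (hf : IsHom k H ρA ρB f) (a : A) : ρB (f a) = LinearMap.rTensor H f (ρA a) :=
  LinearMap.congr_fun hf.2 a

/-- A Yetter-Drinfeld morphism as an `H`-linear map. -/
def toH {A B : Type} [AddCommGroup A] [Module k A] [Module H A]
    [AddCommGroup B] [Module k B] [Module H B]
    {ρA : A →ₗ[k] A ⊗[k] H} {ρB : B →ₗ[k] B ⊗[k] H} {f : A →ₗ[k] B}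
    (hf : IsHom k H ρA ρB f) : A →ₗ[H] B :=
  { toFun := f, map_add' := map_add f, map_smul' := hf.1 }

section map
variable {A B N : Type} [AddCommGroup A] [Module k A] [Module H A] [IsScalarTower k H A]
    [SMulCommClass H k A]
    [AddCommGroup B] [Module k B] [Module H B] [IsScalarTower k H B] [SMulCommClass H k B]
    [AddCommGroup N] [Module k N] [Module H N] [IsScalarTower k H N] [SMulCommClass H k N]
    {ρA : A →ₗ[k] A ⊗[k] H} {ρB : B →ₗ[k] B ⊗[k] H} {f : A →ₗ[k] B}

lemma isHom_rTensor (hf : IsHom k H ρA ρB f) (ρN : N →ₗ[k] N ⊗[k] H)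
  (hA : ∀ (h : H) m, ρA (h • m) = act A H (gam k H h) (ρA m))
  (hB : ∀ (h : H) m, ρB (h • m) = act B H (gam k H h) (ρB m))
  (hN : ∀ (h : H) m, ρN (h • m) = act N H (gam k H h) (ρN m)) :
    IsHom k H (tco ρA ρN hA hN) (tco ρB ρN hB hN)
      ((LinearMap.rTensor N (toH hf)).restrictScalars k) := by
  refine ⟨fun h a => by simp, ?_⟩
  apply LinearMap.ext
  intro x
  simp only [LinearMap.comp_apply, LinearMap.restrictScalars_apply]
  induction x with
  | zero => simp
  | add x y hx hy => simp only [map_add, hx, hy]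
  | tmul a n =>
    rw [LinearMap.rTensor_tmul, tco_tmul, tco_tmul]
    change mm B N H (ρB (f a)) (ρN n) = _
    rw [hf.apply]
    generalize ρA a = x
    generalize ρN n = y
    induction x with
    | zero => simp
    | add z w hz hw => simp only [map_add, LinearMap.add_apply, hz, hw]
    | tmul m r =>
      induction y with
      | zero => simp
      | add z w hz hw => simp only [map_add, hz, hw]
      | tmul n s => simp [toH]

end map

lemma proj_tens (hS : ∀ h, Sinv h = HopfAlgebra.antipode k h) (P N : YDCat k H Sinv)
    (hf : Module.Finite H N.M) (hp : Module.Projective H N.M)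
    (hP : IsProjectiveYD k H Sinv P) : IsProjectiveYD k H Sinv (tensYD hS P N) := by
  intro A B g f hg hgs hfh
  change (P.M ⊗[H] N.M) →ₗ[k] B.M at f
  change IsHom k H (tco P.ρ N.ρ _ _) B.ρ f at hfh
  obtain ⟨rA, hrA⟩ := exists_hom_coact N.ρ A.ρ hf hp (N.act_compat hS) (A.act_compat hS)
  obtain ⟨rB, hrB⟩ := exists_hom_coact N.ρ B.ρ hf hp (N.act_compat hS) (B.act_compat hS)
  let A' : YDCat k H Sinv := YDCat.mk (M := N.M →ₗ[H] A.M) rA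
    (hom_comod rA hrA hf hp N.comod A.comod)
    ((compat_iff hS _).2 (hom_compat rA hrA hf hp (A.act_compat hS)))
  let B' : YDCat k H Sinv := YDCat.mk (M := N.M →ₗ[H] B.M) rB
    (hom_comod rB hrB hf hp N.comod B.comod)
    ((compat_iff hS _).2 (hom_compat rB hrB hf hp (B.act_compat hS)))
  let g' : (N.M →ₗ[H] A.M) →ₗ[k] (N.M →ₗ[H] B.M) := postcompH (X := N.M) g hg.1
  have hg' : IsHom k H rA rB g' := by
    refine ⟨fun h a => by ext n; simp [g', postcompH, hg.1], ?_⟩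
    apply LinearMap.ext
    intro φ
    apply ev_inj hf hp
    intro n
    rw [LinearMap.comp_apply, LinearMap.comp_apply, hrB, DD_apply]
    have e1 : LinearMap.rTensor H (evalAtH (N := B.M) n) (LinearMap.rTensor H g' (rA φ)) =
        LinearMap.rTensor H g (DD N.ρ A.ρ n φ) := by
      rw [← hrA]
      generalize rA φ = z
      induction z with
      | zero => simp
      | add z w hz hw => simp only [map_add, hz, hw]
      | tmul a h => rfl
    rw [e1, DD_apply]
    generalize N.ρ n = y
    induction y with
    | zero => simp
    | add z w hz hw => simp only [map_add, hz, hw]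
    | tmul n h =>
      rw [thet_tmul, thet_tmul]
      change rm k H B.M H _ (B.ρ (g (φ n))) = LinearMap.rTensor H g (rm k H A.M H _ (A.ρ (φ n)))
      rw [hg.apply]
      generalize A.ρ (φ n) = z
      induction z with
      | zero => simp
      | add z w hz hw => simp only [map_add, hz, hw]
      | tmul a h => simp
  have hg's : Function.Surjective g' := by
    intro φ
    obtain ⟨ψ, hψ⟩ := Module.projective_lifting_property (toH hg) φ hgs
    refine ⟨ψ, ?_⟩
    ext n
    exact LinearMap.congr_fun hψ n
  let f' : P.M →ₗ[k] (N.M →ₗ[H] B.M) :=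
    { toFun := fun p =>
        { toFun := fun n => f (p ⊗ₜ n)
          map_add' := fun x y => by rw [tmul_add, map_add]
          map_smul' := fun h x => by
            rw [tmul_smul, RingHom.id_apply]
            exact hfh.1 h (p ⊗ₜ x) }
      map_add' := fun x y => by
        ext n
        simp [add_tmul]
      map_smul' := fun c x => by
        ext n
        simp only [LinearMap.coe_mk, AddHom.coe_mk, RingHom.id_apply, LinearMap.smul_apply]
        rw [← smul_tmul', map_smul] }
  have hf'ap : ∀ p n, f' p n = f (p ⊗ₜ n) := fun _ _ => rfl
  have hf' : IsHom k H P.ρ rB f' := by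
    constructor
    · intro h p
      ext n
      rw [LinearMap.smul_apply, hf'ap, hf'ap, ← smul_tmul']
      exact hfh.1 h (p ⊗ₜ n)
    · apply LinearMap.ext
      intro p
      apply ev_inj hf hp
      intro n
      rw [LinearMap.comp_apply, LinearMap.comp_apply, hrB, DD_apply]
      -- the coaction of `B` on values of `f`
      have key : ∀ x : P.M ⊗[k] H, thet H (HopfAlgebra.antipode k)
          (LinearMap.rTensor H f ∘ₗ (mm (H := H) P.M N.M H x) ∘ₗ N.ρ) (N.ρ n) =
          LinearMap.rTensor H (evalAtH (N := B.M) n) (LinearMap.rTensor H f' x) := by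
        intro x
        induction x with
        | zero =>
          have h0 : thet H (HopfAlgebra.antipode k) (0 : N.M →ₗ[k] B.M ⊗[k] H) = 0 := by
            ext n w
            simp
          rw [map_zero, LinearMap.zero_comp, LinearMap.comp_zero, h0]
          simp
        | add z w hz hw =>
          rw [map_add, LinearMap.add_comp, LinearMap.comp_add, thet_add, LinearMap.add_apply,
            hz, hw, map_add, map_add]
        | tmul p' c =>
          let φ : N.M →ₗ[k] B.M ⊗[k] H :=
            (TensorProduct.mk k B.M H).flip c ∘ₗ (f' p').restrictScalars k
          have e1 : LinearMap.rTensor H f ∘ₗ (mm (H := H) P.M N.M H (p' ⊗ₜ c)) =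
              thet H LinearMap.id φ := by
            ext n' h'
            simp [φ, hf'ap, mul_comm]
          rw [← LinearMap.comp_assoc, e1, thet_thet N.comod]
          · simp [φ, evalAtH]
          · intro h
            exact HopfAlgebra.mul_antipode_lTensor_comul_apply h
      rw [← key]
      congr 2
      ext n'
      exact hfh.apply (p ⊗ₜ n')
  obtain ⟨l, hl, hgl⟩ := hP A' B' g' f' hg' hg's hf'
  change P.M →ₗ[k] (N.M →ₗ[H] A.M) at l
  change IsHom k H P.ρ rA l at hl
  change g' ∘ₗ l = f' at hgl
  let L : P.M ⊗[H] N.M →ₗ[k] A.M := (TensorProduct.lift (toH hl)).restrictScalars k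
  have hL : ∀ p n, L (p ⊗ₜ n) = l p n := fun p n => rfl
  refine ⟨L, ⟨fun h x => ?_, ?_⟩, ?_⟩
  · exact (TensorProduct.lift (toH hl)).map_smul h x
  · change A.ρ ∘ₗ L = LinearMap.rTensor H L ∘ₗ (tco P.ρ N.ρ _ _)
    apply LinearMap.ext
    intro x
    simp only [LinearMap.comp_apply]
    induction x with
    | zero => simp
    | add x y hx hy => simp only [map_add, hx, hy]
    | tmul p n =>
      rw [tco_tmul, hL]
      have h1 := thet_thet N.comod LinearMap.id (HopfAlgebra.antipode k)
        (fun h => HopfAlgebra.mul_antipode_rTensor_comul_apply h)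
        (A.ρ ∘ₗ (l p).restrictScalars k) n
      have key : ∀ (x : P.M ⊗[k] H) (ψ : N.M →ₗ[k] A.M ⊗[k] H),
          (∀ n, ψ n = LinearMap.rTensor H (evalAtH (N := A.M) n) (LinearMap.rTensor H l x)) →
          ∀ y, thet H LinearMap.id ψ y = LinearMap.rTensor H L (mm P.M N.M H x y) := by
        intro x ψ hψ y
        induction y with
        | zero => simp
        | add z w hz hw => simp only [map_add, hz, hw]
        | tmul n h =>
          rw [thet_tmul, hψ]
          clear hψ
          induction x with
          | zero => simp
          | add z w hz hw => simp only [map_add, LinearMap.add_apply, hz, hw]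
          | tmul p c => simp [hL, evalAtH, mul_comm]
      rw [← key (P.ρ p) _ ?_ (N.ρ n)]
      · exact h1.symm
      · intro n'
        rw [← hl.apply, hrA]
        rfl
  · apply LinearMap.ext
    change ∀ x : P.M ⊗[H] N.M, g (L x) = f x
    intro x
    induction x with
    | zero => simp
    | add x y hx hy => simp only [map_add, hx, hy]
    | tmul p n =>
      rw [hL, ← hf'ap, ← hgl]
      rfl

end Main4

/-- Corollary 2.3(1). Let `k` be a field, `H` a commutative Hopf
algebra over `k` with bijective antipode, and `M`, `N` Yetter-Drinfeld modules with
`N` finitely generated projective as a left `H`-module. Then the projective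
dimension of `M ⊗_H N` in the category of Yetter-Drinfeld modules is at most the
projective dimension of `M`. -/
theorem pdim_tensorH_le
    (k H : Type) [Field k] [CommRing H] [HopfAlgebra k H]
    (Sinv : H →ₗ[k] H)
    (hS1 : ∀ h : H, Sinv (HopfAlgebra.antipode (R := k) (A := H) h) = h)
    (hS2 : ∀ h : H, HopfAlgebra.antipode (R := k) (A := H) (Sinv h) = h)
    (M N : YDCat k H Sinv)
    (hNfin : Module.Finite H N.M) (hNproj : Module.Projective H N.M)
    (ρT : (M.M ⊗[H] N.M) →ₗ[k] (M.M ⊗[H] N.M) ⊗[k] H)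
    (hTc : IsComod k H ρT) (hTyd : IsYDCompat k H Sinv ρT)
    (hTchar : TensorCoactChar Sinv M N ρT) :
    ∀ n : ℕ, pdimLE Sinv M n →
      pdimLE Sinv (YDCat.mk (M := M.M ⊗[H] N.M) ρT hTc hTyd) n := by
  have hS : ∀ h, Sinv h = HopfAlgebra.antipode k h := fun h => by
    conv_rhs => rw [← hS2 h]
    rw [antipode_antipode']
  intro n
  have e := char_eq M N (M.act_compat hS) (N.act_compat hS) ρT hTchar
  subst e
  rintro ⟨P, ε, d, hR, hn⟩
  refine ⟨fun i => tensYD hS (P i) N,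
    (LinearMap.rTensor N.M (toH hR.eps_hom)).restrictScalars k,
    fun i => (LinearMap.rTensor N.M (toH (hR.d_hom i))).restrictScalars k, ?_, ?_⟩
  · refine ⟨isHom_rTensor _ _ _ _ _, fun i => isHom_rTensor _ _ _ _ _,
      fun i => proj_tens hS _ _ hNfin hNproj (hR.proj i), ?_, ?_, fun i => ?_⟩
    · exact LinearMap.rTensor_surjective N.M (g := toH hR.eps_hom) hR.epi
    · have h1 : Function.Exact (toH (hR.d_hom 0)) (toH hR.eps_hom) :=
        LinearMap.exact_iff.2 (SetLike.ext fun x => (SetLike.ext_iff.1 hR.exact0 x).symm)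
      have h2 := Module.Flat.rTensor_exact N.M h1
      exact SetLike.ext fun x => (h2 x).symm
    · have h1 : Function.Exact (toH (hR.d_hom (i + 1))) (toH (hR.d_hom i)) :=
        LinearMap.exact_iff.2 (SetLike.ext fun x => (SetLike.ext_iff.1 (hR.exact i) x).symm)
      have h2 := Module.Flat.rTensor_exact N.M h1
      exact SetLike.ext fun x => (h2 x).symm
  · intro i hi
    have := hn i hi
    change Subsingleton ((P i).M ⊗[H] N.M)
    infer_instance
end YDPaper
end
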